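/- arXiv:1203.5624 — 6 statements merged into one kernel-verified Lean document; each statement's English description precedes it below -/
import Mathlib

section
/- Let K be a compact subset of ℝ^m with 0 ∈ K, K = −K, and Euclidean diameter at most ε. Then for every n ∈ ℕ, the Hausdorff distance (with respect to the Euclidean metric) between the n-fold Minkowski sum K^n = {k₁ + ⋯ + k_n : k_i ∈ K} and its convex hull is at most (m+1)ε. -/
open Pointwise

/-- The `n`-fold Minkowski sum `K^n = K + K + ⋯ + K` (`n` summands), with
`K^0 = {0}`. -/
def nfoldSum {E : Type*} [AddCommMonoid E] (K : Set E) : ℕ → Set E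
  | 0 => {0}
  | n + 1 => K + nfoldSum K n

theorem nfoldSum_mono_aux {E : Type*} [AddCommMonoid E] {K : Set E} (h0 : (0 : E) ∈ K)
    {k n : ℕ} (h : k ≤ n) : nfoldSum K k ⊆ nfoldSum K n := by
  induction n, h using Nat.le_induction with
  | base => exact subset_rfl
  | succ n _ ih =>
    intro x hx
    exact ⟨0, h0, x, ih hx, by simp⟩

theorem nfoldSum_add_aux {E : Type*} [AddCommMonoid E] {K : Set E} (k n : ℕ) :
    ∀ x ∈ nfoldSum K k, ∀ y ∈ nfoldSum K n, x + y ∈ nfoldSum K (k + n) := by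
  induction k with
  | zero =>
    intro x hx y hy
    have hx' : x = 0 := hx
    simpa [hx'] using hy
  | succ k ih =>
    rintro x ⟨a, ha, b, hb, rfl⟩ y hy
    rw [Nat.add_right_comm]
    exact ⟨a, ha, b + y, ih b hb y hy, by simp [add_assoc]⟩

theorem nfoldSum_nsmul_aux {E : Type*} [AddCommMonoid E] {K : Set E} {z : E} (hz : z ∈ K)
    (k : ℕ) : k • z ∈ nfoldSum K k := by
  induction k with
  | zero => simp [nfoldSum]
  | succ k ih => exact ⟨z, hz, k • z, ih, by simp [succ_nsmul']⟩

theorem nfoldSum_sum_aux {E ι : Type*} [AddCommMonoid E] {K : Set E} (s : Finset ι)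
    (z : ι → E) (hz : ∀ i, z i ∈ K) (k : ι → ℕ) :
    ∑ i ∈ s, k i • z i ∈ nfoldSum K (∑ i ∈ s, k i) := by
  classical
  induction s using Finset.induction_on with
  | empty => simp [nfoldSum]
  | insert a s ha ih =>
    rw [Finset.sum_insert ha, Finset.sum_insert ha]
    exact nfoldSum_add_aux _ _ _ (nfoldSum_nsmul_aux (hz a) _) _ ih

theorem nfoldSum_subset_aux {E : Type*} [AddCommGroup E] [Module ℝ E] {K : Set E}
    (hK : K.Nonempty) (n : ℕ) : nfoldSum K n ⊆ (n : ℝ) • convexHull ℝ K := by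
  induction n with
  | zero =>
    have := Set.zero_smul_set (α := ℝ) (hK.convexHull (𝕜 := ℝ))
    simp [nfoldSum, this]
  | succ n ih =>
    rw [Nat.cast_succ, add_comm (n : ℝ) 1, (convex_convexHull ℝ K).add_smul zero_le_one n.cast_nonneg,
      one_smul]
    exact Set.add_subset_add (subset_convexHull ℝ K) ih

/-- **Lemma 2.2.5.** Let `K` be a compact symmetric subset of `ℝ^m` containing `0`
of Euclidean diameter at most `ε`. Then for every `n`, the Hausdorff distance
(for the Euclidean metric) between the `n`-fold Minkowski sum `K^n` and its convex
hull is at most `(m+1)ε`. -/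
theorem hausdorffDist_nfoldSum_convexHull_le
    {m : ℕ} (ε : ℝ) (K : Set (EuclideanSpace ℝ (Fin m)))
    (hcomp : IsCompact K) (h0 : (0 : EuclideanSpace ℝ (Fin m)) ∈ K)
    (hsym : K = -K) (hdiam : Metric.diam K ≤ ε) (n : ℕ) :
    Metric.hausdorffDist (nfoldSum K n) (convexHull ℝ (nfoldSum K n)) ≤ (m + 1) * ε := by
  have hε : 0 ≤ ε := Metric.diam_nonneg.trans hdiam
  have hr : 0 ≤ ((m : ℝ) + 1) * ε := by positivity
  refine Metric.hausdorffDist_le_of_mem_dist hr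
    (fun x hx => ⟨x, subset_convexHull ℝ _ hx, by simpa using hr⟩) ?_
  intro x hx
  have hx' := convexHull_min (nfoldSum_subset_aux ⟨0, h0⟩ n)
    ((convex_convexHull ℝ K).smul (n : ℝ)) hx
  obtain ⟨y, hy, rfl⟩ := hx'
  obtain ⟨ι, _, z, w, hz, hai, hw, hw1, rfl⟩ := eq_pos_convex_span_of_mem_convexHull hy
  have hzK : ∀ i, z i ∈ K := fun i => hz ⟨i, rfl⟩
  have hcard : Fintype.card ι ≤ m + 1 := by
    have h1 := hai.card_le_finrank_succ
    have h2 := Submodule.finrank_le (vectorSpan ℝ (Set.range z))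
    rw [finrank_euclideanSpace_fin] at h2
    omega
  have hnw : ∀ i, 0 ≤ (n : ℝ) * w i := fun i => mul_nonneg n.cast_nonneg (hw i).le
  refine ⟨∑ i, ⌊(n : ℝ) * w i⌋₊ • z i, ?_, ?_⟩
  · refine nfoldSum_mono_aux h0 ?_ (nfoldSum_sum_aux _ z hzK _)
    have : ((∑ i, ⌊(n : ℝ) * w i⌋₊ : ℕ) : ℝ) ≤ n := by
      push_cast
      calc ∑ i, (⌊(n : ℝ) * w i⌋₊ : ℝ) ≤ ∑ i, (n : ℝ) * w i :=
            Finset.sum_le_sum fun i _ => Nat.floor_le (hnw i)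
        _ = n := by rw [← Finset.mul_sum, hw1, mul_one]
    exact_mod_cast this
  · have heq : (n : ℝ) • ∑ i, w i • z i - ∑ i, ⌊(n : ℝ) * w i⌋₊ • z i
        = ∑ i, ((n : ℝ) * w i - (⌊(n : ℝ) * w i⌋₊ : ℝ)) • z i := by
      rw [Finset.smul_sum, ← Finset.sum_sub_distrib]
      refine Finset.sum_congr rfl fun i _ => ?_
      rw [sub_smul, mul_smul, Nat.cast_smul_eq_nsmul ℝ ⌊(n : ℝ) * w i⌋₊]
    change dist ((n : ℝ) • ∑ i, w i • z i) _ ≤ _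
    rw [dist_eq_norm, heq]
    calc _ ≤ ∑ i : ι, ε := by
          refine norm_sum_le_of_le _ fun i _ => ?_
          have h1 : ‖z i‖ ≤ ε := by
            rw [← dist_zero_right]
            exact (Metric.dist_le_diam_of_mem hcomp.isBounded (hzK i) h0).trans hdiam
          have h2 := Nat.floor_le (hnw i)
          have h3 := Nat.lt_floor_add_one ((n : ℝ) * w i)
          rw [norm_smul, Real.norm_eq_abs, abs_of_nonneg (by linarith)]
          calc _ ≤ 1 * ‖z i‖ := by gcongr; linarith
            _ ≤ ε := by simpa using h1
      _ = Fintype.card ι * ε := by simp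
      _ ≤ (m + 1) * ε := by gcongr; exact_mod_cast hcard
end

section
/- Let d be a metric on ℝ^m which is translation-invariant (d(x+v, y+v) = d(x,y) for all x,y,v), induces the standard topology on ℝ^m, is proper (closed d-balls are compact), and is geodesic (for any x,y there is an isometric embedding γ : [0, d(x,y)] → (ℝ^m, d) with γ(0)=x and γ(d(x,y))=y). Then there exists a norm N on ℝ^m such that d(x,y) = N(x−y) for all x,y ∈ ℝ^m. -/
/-- `N` is a norm on `ℝ^m`. -/
def IsNorm (m : ℕ) (N : (Fin m → ℝ) → ℝ) : Prop :=
  (∀ x, N x = 0 ↔ x = 0) ∧ (∀ (c : ℝ) (x), N (c • x) = |c| * N x) ∧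
    (∀ x y, N (x + y) ≤ N x + N y)

/-- **Lemma.** A translation-invariant metric `d` on `ℝ^m` which induces the
standard topology, is proper (closed balls are compact) and geodesic, is the
metric associated to a norm: there is a norm `N` on `ℝ^m` with
`d x y = N (x - y)` for all `x, y`. -/
theorem invariant_proper_geodesic_metric_is_norm
    {m : ℕ} (d : (Fin m → ℝ) → (Fin m → ℝ) → ℝ)
    (hself : ∀ x, d x x = 0)
    (hsymm : ∀ x y, d x y = d y x)
    (htri : ∀ x y z, d x z ≤ d x y + d y z)
    (hsep : ∀ x y, d x y = 0 → x = y)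
    (hinv : ∀ x y v, d (x + v) (y + v) = d x y)
    (htop : ∀ s : Set (Fin m → ℝ),
      IsOpen s ↔ ∀ x ∈ s, ∃ ε : ℝ, 0 < ε ∧ ∀ y, d x y < ε → y ∈ s)
    (hproper : ∀ (x : Fin m → ℝ) (r : ℝ), IsCompact {y | d x y ≤ r})
    (hgeo : ∀ x y, ∃ γ : ℝ → (Fin m → ℝ), γ 0 = x ∧ γ (d x y) = y ∧
      ∀ s ∈ Set.Icc (0 : ℝ) (d x y), ∀ t ∈ Set.Icc (0 : ℝ) (d x y),
        d (γ s) (γ t) = |s - t|) :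
    ∃ N : (Fin m → ℝ) → ℝ, IsNorm m N ∧ ∀ x y, d x y = N (x - y) := by
  have hd : ∀ x y, d x y = d 0 (x - y) := by
    intro x y
    have h := hinv 0 (x - y) y
    rw [zero_add, sub_add_cancel] at h
    rw [← h, hsymm]
  set N : (Fin m → ℝ) → ℝ := fun x => d 0 x with hN
  have hdN : ∀ x y, d x y = N (x - y) := hd
  have N0 : N 0 = 0 := hself 0
  have Nadd : ∀ x y, N (x + y) ≤ N x + N y := by
    intro x y
    have h := htri 0 x (x + y)
    have h2 : d x (x + y) = N y := by
      rw [hsymm, hdN]; congr 1; abel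
    rw [h2] at h
    exact h
  have Nneg : ∀ x, N (-x) = N x := by
    intro x
    have h := hdN 0 x
    rw [zero_sub] at h
    exact h.symm
  have Nnn : ∀ x, 0 ≤ N x := by
    intro x
    have h := Nadd x (-x)
    rw [Nneg, add_neg_cancel, N0] at h
    linarith
  have Nnat : ∀ (n : ℕ) x, N ((n : ℝ) • x) ≤ n * N x := by
    intro n x
    induction n with
    | zero => simp [N0]
    | succ k ih =>
      have h := Nadd ((k : ℝ) • x) x
      push_cast
      rw [add_smul, one_smul]
      linarith
  have hcl : ∀ r, IsClosed {y | N y ≤ r} := fun r => (hproper 0 r).isClosed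
  have hhalf : ∀ x, N ((1 / 2 : ℝ) • x) ≤ N x / 2 := by
    intro x
    obtain ⟨M, hM⟩ : ∃ M, ∀ y, N y ≤ N x → y ⬝ᵥ y ≤ M := by
      have hc : Continuous (fun y : Fin m → ℝ => y ⬝ᵥ y) := by
        unfold dotProduct; fun_prop
      obtain ⟨M, hM⟩ := ((hproper 0 (N x)).image hc).bddAbove
      exact ⟨M, fun y hy => hM ⟨y, hy, rfl⟩⟩
    obtain ⟨γ, g0, g1, hg⟩ := hgeo 0 x
    have key : ∀ n : ℕ, ∃ w, N w ≤ N x / 2 ∧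
        ((2 : ℝ) • w - x) ⬝ᵥ ((2 : ℝ) • w - x) ≤ M / ((n : ℝ) + 1) := by
      intro n
      have hn : (0 : ℝ) < (n : ℝ) + 1 := by positivity
      have ind : ∀ i : ℕ, i ≤ n + 1 → ∃ y z, y + z = γ (i * (N x / (n + 1))) ∧
          N y + N z ≤ i * (N x / (n + 1)) ∧
          (y - z) ⬝ᵥ (y - z) ≤ i * (M / ((n : ℝ) + 1) ^ 2) := by
        intro i
        induction i with
        | zero => intro _; exact ⟨0, 0, by simp [g0], by simp [N0], by simp⟩
        | succ k ih =>
          intro hk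
          obtain ⟨y, z, h1, h2, h3⟩ := ih (by omega)
          have hmem : ∀ j : ℕ, j ≤ n + 1 →
              (j : ℝ) * (N x / (n + 1)) ∈ Set.Icc (0 : ℝ) (d 0 x) := by
            intro j hj
            have hj' : (j : ℝ) ≤ n + 1 := by exact_mod_cast hj
            have hp : 0 ≤ N x / ((n : ℝ) + 1) := div_nonneg (Nnn x) hn.le
            refine ⟨by positivity, ?_⟩
            calc (j : ℝ) * (N x / (n + 1)) ≤ (n + 1) * (N x / (n + 1)) := by gcongr
              _ = N x := by field_simp
          obtain ⟨p, hp⟩ : ∃ p, p = γ (((k + 1 : ℕ) : ℝ) * (N x / (n + 1)))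
            - γ (k * (N x / (n + 1))) := ⟨_, rfl⟩
          have hNp : N p = N x / (n + 1) := by
            rw [hp, ← hdN, hg _ (hmem _ hk) _ (hmem _ (by omega))]
            push_cast
            rw [← sub_mul, add_sub_cancel_left, one_mul, abs_of_nonneg]
            exact div_nonneg (Nnn x) hn.le
          have hQp : p ⬝ᵥ p ≤ M / ((n : ℝ) + 1) ^ 2 := by
            have h := hM (((n + 1 : ℕ) : ℝ) • p) (by
              refine (Nnat _ _).trans ?_
              rw [hNp]; push_cast
              exact le_of_eq (by field_simp))
            rw [smul_dotProduct, dotProduct_smul] at h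
            push_cast at h
            rw [le_div_iff₀ (by positivity)]
            simp only [smul_eq_mul] at h
            linarith
          have hγ : γ (((k + 1 : ℕ) : ℝ) * (N x / (n + 1))) = y + z + p := by
            rw [hp, h1]; abel
          rw [hγ]
          push_cast
          rcases le_total ((y - z) ⬝ᵥ p) 0 with hs | hs
          · refine ⟨y + p, z, by abel, ?_, ?_⟩
            · linarith [Nadd y p]
            · have e : y + p - z = (y - z) + p := by abel
              rw [e, add_dotProduct, dotProduct_add, dotProduct_add, dotProduct_comm p (y - z)]
              linarith
          · refine ⟨y, z + p, by abel, ?_, ?_⟩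
            · linarith [Nadd z p]
            · have e : y - (z + p) = (y - z) - p := by abel
              rw [e, sub_dotProduct (y - z) p, dotProduct_sub (y - z) (y - z) p, dotProduct_sub p (y - z) p,
                dotProduct_comm p (y - z)]
              linarith
      obtain ⟨y, z, h1, h2, h3⟩ := ind (n + 1) le_rfl
      have e1 : ((n + 1 : ℕ) : ℝ) * (N x / (n + 1)) = N x := by push_cast; field_simp
      have e2 : ((n + 1 : ℕ) : ℝ) * (M / ((n : ℝ) + 1) ^ 2) = M / ((n : ℝ) + 1) := by
        push_cast; field_simp
      rw [e1] at h1 h2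
      rw [e2] at h3
      have h1' : y + z = x := h1.trans g1
      rcases le_total (N y) (N z) with h | h
      · refine ⟨y, by linarith, ?_⟩
        have e : (2 : ℝ) • y - x = y - z := by rw [← h1', two_smul]; abel
        rw [e]; exact h3
      · refine ⟨z, by linarith, ?_⟩
        have e : (2 : ℝ) • z - x = -(y - z) := by rw [← h1', two_smul]; abel
        rw [e, neg_dotProduct_neg]; exact h3
    choose w hw1 hw2 using key
    have hlim : Filter.Tendsto w Filter.atTop (nhds ((1 / 2 : ℝ) • x)) := by
      rw [tendsto_pi_nhds]
      intro j
      have hz : Filter.Tendsto (fun n : ℕ => √(M / ((n : ℝ) + 1))) Filter.atTop (nhds 0) := by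
        have h := (tendsto_one_div_add_atTop_nhds_zero_nat (𝕜 := ℝ)).const_mul M
        have h2 := (Real.continuous_sqrt.tendsto _).comp h
        simpa [Function.comp_def, div_eq_mul_inv] using h2
      rw [tendsto_iff_dist_tendsto_zero]
      refine squeeze_zero (fun _ => dist_nonneg) (fun n => ?_) hz
      rw [Real.dist_eq]
      apply Real.abs_le_sqrt
      have h := hw2 n
      have h' : ((2 : ℝ) • w n - x) j * ((2 : ℝ) • w n - x) j
          ≤ ((2 : ℝ) • w n - x) ⬝ᵥ ((2 : ℝ) • w n - x) :=
        Finset.single_le_sum (f := fun j => ((2 : ℝ) • w n - x) j * ((2 : ℝ) • w n - x) j)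
          (fun i _ => mul_self_nonneg _) (Finset.mem_univ j)
      simp only [Pi.sub_apply, Pi.smul_apply, smul_eq_mul] at h' ⊢
      nlinarith [sq_nonneg (w n j - 1 / 2 * x j)]
    exact (hcl (N x / 2)).mem_of_tendsto hlim (Filter.Eventually.of_forall hw1)
  have hpow : ∀ (k : ℕ) x, N (((1 / 2 : ℝ) ^ k) • x) ≤ (1 / 2 : ℝ) ^ k * N x := by
    intro k x
    induction k with
    | zero => simp
    | succ k ih =>
      have h := hhalf (((1 / 2 : ℝ) ^ k) • x)
      rw [smul_smul] at h
      rw [pow_succ']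
      linarith
  have hle : ∀ t : ℝ, 0 ≤ t → ∀ x, N (t • x) ≤ t * N x := by
    intro t ht x
    have hfl : Filter.Tendsto (fun k : ℕ => (⌊t * 2 ^ k⌋₊ : ℝ) / 2 ^ k) Filter.atTop (nhds t) :=
      (tendsto_nat_floor_mul_div_atTop ht).comp
        (tendsto_pow_atTop_atTop_of_one_lt (one_lt_two : (1 : ℝ) < 2))
    refine (hcl (t * N x)).mem_of_tendsto (hfl.smul_const x) (Filter.Eventually.of_forall ?_)
    intro k
    have h1 := Nnat ⌊t * 2 ^ k⌋₊ (((1 / 2 : ℝ) ^ k) • x)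
    have h2 := hpow k x
    have h3 : (⌊t * 2 ^ k⌋₊ : ℝ) ≤ t * 2 ^ k := Nat.floor_le (by positivity)
    have e : (⌊t * 2 ^ k⌋₊ : ℝ) / 2 ^ k = (⌊t * 2 ^ k⌋₊ : ℝ) * (1 / 2 : ℝ) ^ k := by
      rw [one_div, inv_pow, div_eq_mul_inv]
    change N (((⌊t * 2 ^ k⌋₊ : ℝ) / 2 ^ k) • x) ≤ t * N x
    rw [e, ← smul_smul]
    have hx := Nnn x
    calc _ ≤ (⌊t * 2 ^ k⌋₊ : ℝ) * N (((1 / 2 : ℝ) ^ k) • x) := h1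
      _ ≤ (t * 2 ^ k) * ((1 / 2 : ℝ) ^ k * N x) := by
        gcongr
        exact Nnn _
      _ = t * N x := by
        rw [one_div, inv_pow]; field_simp
  have hpos : ∀ t : ℝ, 0 ≤ t → ∀ x, N (t • x) = t * N x := by
    intro t ht x
    refine le_antisymm (hle t ht x) ?_
    rcases ht.eq_or_lt with h | h
    · simp [← h, N0]
    · have h1 := hle t⁻¹ (by positivity) (t • x)
      rw [smul_smul, inv_mul_cancel₀ h.ne', one_smul] at h1
      calc t * N x ≤ t * (t⁻¹ * N (t • x)) := by gcongr
        _ = N (t • x) := by field_simp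
  refine ⟨N, ⟨fun x => ⟨fun h => (hsep 0 x h).symm, fun h => by rw [h, N0]⟩, ?_, Nadd⟩, hdN⟩
  intro c x
  rcases le_total 0 c with h | h
  · rw [abs_of_nonneg h, hpos c h]
  · rw [abs_of_nonpos h, ← hpos (-c) (by linarith), neg_smul, Nneg]
end

section
/- Let X be a connected graph in which every vertex has degree at most d, let G be a group acting transitively on X by graph automorphisms, let G' ≤ G be a subgroup of finite index m, and let X' be a G'-orbit of vertices. Then: (i) every vertex of X is at graph distance at most m from X'; (ii) define a graph structure on X' by joining two vertices of X' whenever their distance in X is at most 2m+1; then this graph is connected and for all y,y' ∈ X' one has d_{X'}(y,y') ≤ d_X(y,y') ≤ (2m+1)·d_{X'}(y,y'); (iii) every vertex of the graph X' has degree at most d^{2m+1}. -/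
theorem fis_exists_step {V : Type*} (Γ : SimpleGraph V) (hconn : Γ.Connected) (w y : V) (k : ℕ)
    (h : Γ.dist w y = k + 1) : ∃ u, Γ.Adj w u ∧ Γ.dist u y = k := by
  obtain ⟨p, hp⟩ := hconn.exists_walk_length_eq_dist w y
  rw [h] at hp
  cases p with
  | nil => simp at hp
  | @cons _ u _ ha q =>
    refine ⟨u, ha, ?_⟩
    have h1 : Γ.dist u y ≤ q.length := SimpleGraph.dist_le q
    have h2 : Γ.dist w y ≤ Γ.dist w u + Γ.dist u y := hconn.dist_triangle
    have h3 : Γ.dist w u = 1 := SimpleGraph.dist_eq_one_iff_adj.2 ha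
    simp at hp
    omega

theorem fis_ball {V : Type*} (Γ : SimpleGraph V) (hconn : Γ.Connected) (d : ℕ)
    (hdeg : ∀ v : V, (Γ.neighborSet v).Finite ∧ (Γ.neighborSet v).ncard ≤ d) (y : V) (n : ℕ) :
    ∃ s : Finset V, s.card ≤ d ^ (n + 1) ∧ ∀ z, z ∈ s ↔ z ≠ y ∧ Γ.dist z y ≤ n + 1 := by
  classical
  induction n with
  | zero =>
    refine ⟨(hdeg y).1.toFinset, ?_, ?_⟩
    · rw [← Set.ncard_eq_toFinset_card _ (hdeg y).1]
      simpa using (hdeg y).2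
    · intro z
      simp only [Set.Finite.mem_toFinset, SimpleGraph.mem_neighborSet]
      constructor
      · intro h
        exact ⟨h.ne', by rw [SimpleGraph.dist_eq_one_iff_adj.2 h.symm]⟩
      · rintro ⟨h1, h2⟩
        have := hconn.pos_dist_of_ne h1
        exact (SimpleGraph.dist_eq_one_iff_adj.1 (by omega : Γ.dist z y = 1)).symm
  | succ n ih =>
    obtain ⟨s, hs, hmem⟩ := ih
    have hpar : ∀ x : V, ∃ u, x ≠ y → Γ.Adj x u ∧ Γ.dist u y + 1 = Γ.dist x y := by
      intro x
      by_cases hx : x = y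
      · exact ⟨x, fun h => absurd hx h⟩
      · have := hconn.pos_dist_of_ne hx
        obtain ⟨k, hk⟩ := Nat.exists_eq_succ_of_ne_zero this.ne'
        obtain ⟨u, hu, hu2⟩ := fis_exists_step Γ hconn x y k hk
        exact ⟨u, fun _ => ⟨hu, by omega⟩⟩
    choose p hp using hpar
    let T : V → Finset V := fun x => insert x ((hdeg x).1.toFinset.erase (p x))
    have hT : ∀ x ∈ s, (T x).card ≤ d := by
      intro x hx
      have hpx := hp x ((hmem x).1 hx).1
      have h1 : p x ∈ (hdeg x).1.toFinset := by simpa using hpx.1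
      have h2 := Finset.card_erase_add_one h1
      have h3 := (hdeg x).2
      rw [Set.ncard_eq_toFinset_card _ (hdeg x).1] at h3
      have h4 := Finset.card_insert_le x ((hdeg x).1.toFinset.erase (p x))
      simp only [T]
      omega
    refine ⟨(s.biUnion T).filter (fun z => z ≠ y ∧ Γ.dist z y ≤ n + 1 + 1), ?_, ?_⟩
    · calc _ ≤ (s.biUnion T).card := Finset.card_filter_le _ _
        _ ≤ s.card * d := Finset.card_biUnion_le_card_mul _ _ _ hT
        _ ≤ d ^ (n + 1) * d := Nat.mul_le_mul_right _ hs
        _ = _ := (pow_succ _ _).symm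
    · intro z
      rw [Finset.mem_filter]
      refine ⟨fun h => h.2, fun h => ⟨?_, h⟩⟩
      rw [Finset.mem_biUnion]
      by_cases hz : Γ.dist z y ≤ n + 1
      · exact ⟨z, (hmem z).2 ⟨h.1, hz⟩, by simp [T]⟩
      · obtain ⟨u, hu, hu2⟩ := fis_exists_step Γ hconn z y (n + 1) (by omega)
        have huy : u ≠ y := by
          rintro rfl
          simp at hu2
        refine ⟨u, (hmem u).2 ⟨huy, by omega⟩, ?_⟩
        have := (hp u huy).2
        simp only [T, Finset.mem_insert, Finset.mem_erase, Set.Finite.mem_toFinset,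
          SimpleGraph.mem_neighborSet]
        refine Or.inr ⟨?_, hu.symm⟩
        intro hzp
        rw [← hzp] at this
        omega

theorem fis_near {V : Type*} (Γ : SimpleGraph V) (hconn : Γ.Connected)
    (G : Type*) [Group G] [MulAction G V]
    (hact : ∀ (g : G) (u v : V), Γ.Adj u v → Γ.Adj (g • u) (g • v))
    (htrans : ∀ u v : V, ∃ g : G, g • u = v)
    (G' : Subgroup G) (m : ℕ) (hm : 0 < m) (hidx : G'.index = m)
    (v₀ : V) (X' : Set V) (hX' : X' = {v | ∃ g ∈ G', g • v₀ = v}) :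
    ∀ v : V, ∃ y ∈ X', Γ.dist v y ≤ m := by
  classical
  have hdist : ∀ (g : G) (u v : V), Γ.dist (g • u) (g • v) ≤ Γ.dist u v := by
    intro g u v
    obtain ⟨p, hp⟩ := hconn.exists_walk_length_eq_dist u v
    let f : Γ →g Γ := ⟨fun x => g • x, fun h => hact g _ _ h⟩
    have := SimpleGraph.dist_le (p.map f)
    rw [SimpleGraph.Walk.length_map, hp] at this
    exact this
  have hX : ∀ g ∈ G', ∀ y ∈ X', g • y ∈ X' := by
    intro g hg y hy
    rw [hX'] at hy ⊢
    obtain ⟨h, hh, rfl⟩ := hy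
    exact ⟨g * h, G'.mul_mem hg hh, mul_smul _ _ _⟩
  have hv0 : v₀ ∈ X' := by
    rw [hX']
    exact ⟨1, G'.one_mem, one_smul _ _⟩
  let δ : V → ℕ := fun v => sInf ((fun y => Γ.dist v y) '' X')
  have hatt : ∀ v, ∃ y ∈ X', Γ.dist v y = δ v := fun v =>
    Nat.sInf_mem (s := (fun y => Γ.dist v y) '' X') ⟨_, v₀, hv0, rfl⟩
  have hle : ∀ v, ∀ y ∈ X', δ v ≤ Γ.dist v y := fun v y hy => Nat.sInf_le ⟨y, hy, rfl⟩
  have hinv1 : ∀ g ∈ G', ∀ v, δ (g • v) ≤ δ v := by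
    intro g hg v
    obtain ⟨y, hy, h⟩ := hatt v
    rw [← h]
    exact (hle _ _ (hX g hg y hy)).trans (hdist _ _ _)
  have hinv : ∀ g ∈ G', ∀ v, δ (g • v) = δ v := by
    intro g hg v
    refine le_antisymm (hinv1 g hg v) ?_
    have := hinv1 g⁻¹ (G'.inv_mem hg) (g • v)
    rwa [inv_smul_smul] at this
  have hstep : ∀ w k, δ w = k + 1 → ∃ u, δ u = k := by
    intro w k h
    obtain ⟨y, hy, hwy⟩ := hatt w
    obtain ⟨u, hu, huy⟩ := fis_exists_step Γ hconn w y k (hwy.trans h)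
    obtain ⟨z, hz, huz⟩ := hatt u
    have h1 := hle u y hy
    have h2 := hle w z hz
    have h3 : Γ.dist w z ≤ Γ.dist w u + Γ.dist u z := hconn.dist_triangle
    have h4 : Γ.dist w u = 1 := SimpleGraph.dist_eq_one_iff_adj.2 hu
    exact ⟨u, by omega⟩
  have hall : ∀ n w, δ w = n → ∀ k ≤ n, ∃ u, δ u = k := by
    intro n
    induction n with
    | zero => intro w hw k hk; exact ⟨w, by omega⟩
    | succ n ih =>
      intro w hw k hk
      rcases Nat.lt_or_ge n k with h | h
      · exact ⟨w, by omega⟩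
      · obtain ⟨u, hu⟩ := hstep w n hw
        exact ih u hu k h
  intro v
  obtain ⟨y, hy, hvy⟩ := hatt v
  refine ⟨y, hy, ?_⟩
  rw [hvy]
  have hg : ∀ k : Fin (δ v + 1), ∃ g : G, δ (g • v₀) = k := by
    intro k
    obtain ⟨u, hu⟩ := hall _ v rfl k (by omega)
    obtain ⟨g, hg⟩ := htrans v₀ u
    exact ⟨g, by rw [hg, hu]⟩
  choose g hg using hg
  haveI : G'.FiniteIndex := ⟨by omega⟩
  have hinj : Function.Injective (fun k => (((g k)⁻¹ : G) : G ⧸ G')) := by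
    intro i j hij
    have hmem := QuotientGroup.eq.1 hij
    rw [inv_inv] at hmem
    have := hinv _ hmem (g j • v₀)
    rw [mul_smul, inv_smul_smul, hg, hg] at this
    exact Fin.ext this
  have hc := Nat.card_le_card_of_injective _ hinj
  rw [Nat.card_fin] at hc
  have : Nat.card (G ⧸ G') = m := hidx
  omega

/-- **Lemma 2.4.1 (finite index subgraph).** Let `X` be a connected graph of
degree at most `d`, `G` a group acting transitively on `X` by automorphisms,
`G' ≤ G` a subgroup of finite index `m`, and `X'` a `G'`-orbit of vertices. Put
on `X'` the graph structure joining two distinct vertices at `X`-distance at most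
`2m+1`. Then: (i) every vertex of `X` is at distance at most `m` from `X'`;
(ii) the graph `X'` is connected and `d_{X'}(y,y') ≤ d_X(y,y') ≤ (2m+1)·d_{X'}(y,y')`;
(iii) every vertex of `X'` has degree at most `d^(2m+1)`. -/
theorem finite_index_subgraph
    {V : Type*} (Γ : SimpleGraph V) (hconn : Γ.Connected) (d : ℕ)
    (hdeg : ∀ v : V, (Γ.neighborSet v).Finite ∧ (Γ.neighborSet v).ncard ≤ d)
    (G : Type*) [Group G] [MulAction G V]
    (hact : ∀ (g : G) (u v : V), Γ.Adj u v → Γ.Adj (g • u) (g • v))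
    (htrans : ∀ u v : V, ∃ g : G, g • u = v)
    (G' : Subgroup G) (m : ℕ) (hm : 0 < m) (hidx : G'.index = m)
    (v₀ : V) (X' : Set V) (hX' : X' = {v | ∃ g ∈ G', g • v₀ = v})
    (Γ' : SimpleGraph X')
    (hΓ' : ∀ a b : X', Γ'.Adj a b ↔ a ≠ b ∧ Γ.dist (a : V) (b : V) ≤ 2 * m + 1) :
    (∀ v : V, ∃ y ∈ X', Γ.dist v y ≤ m) ∧
    Γ'.Connected ∧
    (∀ y y' : X', Γ'.dist y y' ≤ Γ.dist (y : V) (y' : V) ∧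
      Γ.dist (y : V) (y' : V) ≤ (2 * m + 1) * Γ'.dist y y') ∧
    (∀ y : X', (Γ'.neighborSet y).Finite ∧ (Γ'.neighborSet y).ncard ≤ d ^ (2 * m + 1)) := by
  classical
  have hnear := fis_near Γ hconn G hact htrans G' m hm hidx v₀ X' hX'
  have hr : ∀ v : V, ∃ y : X', Γ.dist v y ≤ m ∧ (v ∈ X' → (y : V) = v) := by
    intro v
    by_cases hv : v ∈ X'
    · exact ⟨⟨v, hv⟩, by simp, fun _ => rfl⟩
    · obtain ⟨y, hy, h⟩ := hnear v
      exact ⟨⟨y, hy⟩, h, fun h => absurd h hv⟩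
  choose r hr1 hr2 using hr
  have hrr : ∀ y : X', r y = y := fun y => Subtype.ext (hr2 y y.2)
  have hw : ∀ (u v : V) (p : Γ.Walk u v), ∃ q : Γ'.Walk (r u) (r v), q.length ≤ p.length := by
    intro u v p
    induction p with
    | nil => exact ⟨SimpleGraph.Walk.nil, le_rfl⟩
    | @cons u w v ha p ih =>
      obtain ⟨q, hq⟩ := ih
      by_cases h : r u = r w
      · rw [h]
        exact ⟨q, by simp; omega⟩
      · have hadj : Γ'.Adj (r u) (r w) := by
          rw [hΓ']
          refine ⟨h, ?_⟩
          have h1 : Γ.dist (r u : V) (r w) ≤ Γ.dist (r u : V) u + Γ.dist u (r w) :=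
            hconn.dist_triangle
          have h2 : Γ.dist u (r w) ≤ Γ.dist u w + Γ.dist w (r w) := hconn.dist_triangle
          have h3 : Γ.dist u w = 1 := SimpleGraph.dist_eq_one_iff_adj.2 ha
          have h4 := hr1 u
          have h5 := hr1 w
          rw [SimpleGraph.dist_comm] at h4
          omega
        exact ⟨SimpleGraph.Walk.cons hadj q, by simpa using hq⟩
  have hw' : ∀ y y' : X', ∃ q : Γ'.Walk y y', q.length ≤ Γ.dist (y : V) y' := by
    intro y y'
    obtain ⟨p, hp⟩ := hconn.exists_walk_length_eq_dist (y : V) y'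
    obtain ⟨q, hq⟩ := hw _ _ p
    exact ⟨q.copy (hrr y) (hrr y'), by rw [SimpleGraph.Walk.length_copy]; omega⟩
  have hne : Nonempty X' := ⟨r v₀⟩
  have hconn' : Γ'.Connected := by
    refine (SimpleGraph.connected_iff _).2 ⟨fun y y' => ?_, hne⟩
    obtain ⟨q, -⟩ := hw' y y'
    exact ⟨q⟩
  refine ⟨hnear, hconn', fun y y' => ⟨?_, ?_⟩, fun y => ?_⟩
  · obtain ⟨q, hq⟩ := hw' y y'
    exact (SimpleGraph.dist_le q).trans hq
  · obtain ⟨p, hp⟩ := hconn'.exists_walk_length_eq_dist y y'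
    rw [← hp]
    clear hp
    induction p with
    | nil => simp
    | @cons a b c ha p ih =>
      have h1 := ((hΓ' a b).1 ha).2
      have h2 : Γ.dist (a : V) c ≤ Γ.dist (a : V) b + Γ.dist (b : V) c := hconn.dist_triangle
      rw [SimpleGraph.Walk.length_cons, Nat.mul_succ]
      omega
  · obtain ⟨s, hs, hmem⟩ := fis_ball Γ hconn d hdeg y (2 * m)
    have hsub : Subtype.val '' (Γ'.neighborSet y) ⊆ (s : Set V) := by
      rintro _ ⟨z, hz, rfl⟩
      have := (hΓ' y z).1 hz
      rw [Finset.mem_coe, hmem, SimpleGraph.dist_comm]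
      exact ⟨fun h => this.1 (Subtype.ext h.symm), this.2⟩
    refine ⟨Set.Finite.of_finite_image (s.finite_toSet.subset hsub)
      Subtype.val_injective.injOn, ?_⟩
    rw [← Set.ncard_image_of_injective _ Subtype.val_injective]
    refine (Set.ncard_le_ncard hsub s.finite_toSet).trans ?_
    rwa [Set.ncard_coe_finset]
end

section
/- Fix q > 0, C > 0 and R₀ ≥ 1, and set K = 100^{2q}. There exists D₀ (depending only on q, C and R₀) with the following property: for every finite connected vertex-transitive graph X with diameter D ≥ D₀ and |X| ≤ C·D^q, there exists an integer R with R₀ ≤ R ≤ D^{1/2} such that |B(x, 100R)| ≤ K·|B(x, R)| for every vertex x of X. -/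
lemma dbl_dist_le_map {V : Type} (Γ : SimpleGraph V) (hc : Γ.Connected) (φ : Γ ≃g Γ) (a b : V) :
    Γ.dist (φ a) (φ b) ≤ Γ.dist a b := by
  obtain ⟨p, hp⟩ := hc.exists_walk_length_eq_dist a b
  have := SimpleGraph.dist_le (p.map φ.toHom)
  rw [SimpleGraph.Walk.length_map, hp] at this
  exact this

lemma dbl_ball_le {V : Type} [Fintype V] (Γ : SimpleGraph V) (hc : Γ.Connected)
    (ht : ∀ u v : V, ∃ φ : Γ ≃g Γ, φ u = v) (x y : V) (r : ℕ) :
    ({v | Γ.dist x v ≤ r}).ncard ≤ ({v | Γ.dist y v ≤ r}).ncard := by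
  obtain ⟨φ, rfl⟩ := ht x y
  refine Set.ncard_le_ncard_of_injOn φ ?_ (fun a _ b _ h => φ.injective h) (Set.toFinite _)
  intro a ha
  exact (dbl_dist_le_map Γ hc φ x a).trans ha

lemma dbl_packing {V : Type} [Fintype V] (Γ : SimpleGraph V) (hc : Γ.Connected)
    (ht : ∀ u v : V, ∃ φ : Γ ≃g Γ, φ u = v) (x : V) (r : ℕ) :
    (Γ.diam + 1) * ({v | Γ.dist x v ≤ r}).ncard ≤ Nat.card V * (2 * r + 1) := by
  classical
  have := hc.nonempty
  obtain ⟨u, v, huv⟩ := Γ.exists_dist_eq_diam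
  obtain ⟨p, hp⟩ := hc.exists_walk_length_eq_dist u v
  have hdist : ∀ i ≤ Γ.diam, Γ.dist u (p.getVert i) = i := by
    intro i hi
    have h1 := SimpleGraph.dist_le (p.take i)
    have h2 := SimpleGraph.dist_le (p.drop i)
    have h3 := hc.dist_triangle (u := u) (v := p.getVert i) (w := v)
    rw [SimpleGraph.Walk.take_length] at h1
    rw [SimpleGraph.Walk.drop_length] at h2
    omega
  have key := Finset.card_mul_le_card_mul (s := Finset.range (Γ.diam + 1))
    (t := (Finset.univ : Finset V)) (fun i w => Γ.dist (p.getVert i) w ≤ r)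
    (m := ({v | Γ.dist x v ≤ r}).ncard) (n := 2 * r + 1) ?_ ?_
  · simpa using key
  · intro i _
    refine (dbl_ball_le Γ hc ht x (p.getVert i) r).trans (le_of_eq ?_)
    rw [← Set.ncard_coe_finset]
    congr 1
    ext w
    simp [Finset.bipartiteAbove]
  · intro w _
    have : (Finset.range (Γ.diam + 1)).bipartiteBelow
        (fun i w => Γ.dist (p.getVert i) w ≤ r) w ⊆
        Finset.Icc (Γ.dist u w - r) (Γ.dist u w + r) := by
      intro i hi
      simp only [Finset.bipartiteBelow, Finset.mem_filter, Finset.mem_range] at hi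
      have h1 := hdist i (by omega)
      have h2 := hc.dist_triangle (u := u) (v := p.getVert i) (w := w)
      have h3 := hc.dist_triangle (u := u) (v := w) (w := p.getVert i)
      rw [SimpleGraph.dist_comm (u := w)] at h3
      simp only [Finset.mem_Icc]
      omega
    refine (Finset.card_le_card this).trans ?_
    rw [Nat.card_Icc]
    omega

theorem doubling_at_some_scale
    (q C : ℝ) (hq : 0 < q) (hC : 0 < C) (R₀ : ℕ) (hR₀ : 1 ≤ R₀) :
    ∃ D₀ : ℝ, ∀ (V : Type) (_ : Fintype V) (Γ : SimpleGraph V),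
      Γ.Connected →
      (∀ u v : V, ∃ φ : Γ ≃g Γ, φ u = v) →
      D₀ ≤ (Γ.diam : ℝ) →
      (Nat.card V : ℝ) ≤ C * (Γ.diam : ℝ) ^ q →
      ∃ R : ℕ, R₀ ≤ R ∧ (R : ℝ) ≤ (Γ.diam : ℝ) ^ ((1 : ℝ) / 2) ∧
        ∀ x : V, (({v | Γ.dist x v ≤ 100 * R}).ncard : ℝ) ≤
          (100 : ℝ) ^ (2 * q) * (({v | Γ.dist x v ≤ R}).ncard : ℝ) := by
  have hR₀' : (1 : ℝ) ≤ R₀ := by exact_mod_cast hR₀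
  refine ⟨(300 * C * (R₀ : ℝ) ^ (2 * q) + R₀) ^ 2, ?_⟩
  intro V _ Γ hc ht hD hcard
  by_contra! hcon
  have := hc.nonempty
  obtain ⟨x⟩ := hc.nonempty
  set D : ℝ := (Γ.diam : ℝ) with hDdef
  set b : ℕ → ℝ := fun r => (({v | Γ.dist x v ≤ r}).ncard : ℝ) with hb
  have hpos : (0 : ℝ) < (R₀ : ℝ) ^ (2 * q) := by positivity
  set s : ℝ := D ^ ((1 : ℝ) / 2) with hs
  have hD0 : 0 ≤ D := Nat.cast_nonneg _
  have hs0 : 0 ≤ s := by positivity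
  have hss : s ^ 2 = D := by
    rw [hs, ← Real.sqrt_eq_rpow, Real.sq_sqrt hD0]
  have hsbig : 300 * C * (R₀ : ℝ) ^ (2 * q) + R₀ ≤ s := by
    rw [← hss] at hD
    exact le_of_sq_le_sq hD hs0
  have hstep : ∀ R : ℕ, R₀ ≤ R → (R : ℝ) ≤ s → (100 : ℝ) ^ (2 * q) * b R ≤ b (100 * R) := by
    intro R h1 h2
    obtain ⟨y, hy⟩ := hcon R h1 h2
    have e1 : b R ≤ (({v | Γ.dist y v ≤ R}).ncard : ℝ) := by
      exact Nat.cast_le.2 (dbl_ball_le Γ hc ht x y R)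
    have e2 : (({v | Γ.dist y v ≤ 100 * R}).ncard : ℝ) ≤ b (100 * R) := by
      exact Nat.cast_le.2 (dbl_ball_le Γ hc ht y x (100 * R))
    exact (mul_le_mul_of_nonneg_left e1 (by positivity)).trans (hy.le.trans e2)
  have hb0 : 1 ≤ b R₀ := by
    have : 0 < ({v | Γ.dist x v ≤ R₀}).ncard := by
      rw [Set.ncard_pos (Set.toFinite _)]
      exact ⟨x, by simp⟩
    show (1 : ℝ) ≤ (({v | Γ.dist x v ≤ R₀}).ncard : ℝ)
    exact_mod_cast this
  -- iterate
  have hiter : ∀ k : ℕ, (∀ j < k, ((R₀ * 100 ^ j : ℕ) : ℝ) ≤ s) →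
      ((100 : ℝ) ^ k) ^ (2 * q) ≤ b (R₀ * 100 ^ k) := by
    intro k
    induction k with
    | zero => intro _; simpa using hb0
    | succ k ih =>
      intro h
      have h1 := ih (fun j hj => h j (by omega))
      have h2 := hstep (R₀ * 100 ^ k) (Nat.le_mul_of_pos_right _ (by positivity)) (h k (by omega))
      rw [show R₀ * 100 ^ (k + 1) = 100 * (R₀ * 100 ^ k) by ring, pow_succ',
        Real.mul_rpow (by positivity) (by positivity)]
      exact (mul_le_mul_of_nonneg_left h1 (by positivity)).trans h2
  have hex : ∃ k : ℕ, s < ((R₀ * 100 ^ k : ℕ) : ℝ) := by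
    obtain ⟨k, hk⟩ := pow_unbounded_of_one_lt s (show (1 : ℝ) < 100 by norm_num)
    refine ⟨k, hk.trans_le ?_⟩
    push_cast
    exact le_mul_of_one_le_left (by positivity) hR₀'
  classical
  obtain ⟨k, hk, hmin⟩ : ∃ k : ℕ, s < ((R₀ * 100 ^ k : ℕ) : ℝ) ∧
      ∀ j < k, ((R₀ * 100 ^ j : ℕ) : ℝ) ≤ s :=
    ⟨Nat.find hex, Nat.find_spec hex, fun j hj => not_lt.1 (Nat.find_min hex hj)⟩
  have hk0 : k ≠ 0 := by
    rintro rfl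
    simp at hk
    have : 0 < 300 * C * (R₀ : ℝ) ^ (2 * q) := by positivity
    linarith
  obtain ⟨j, rfl⟩ := Nat.exists_eq_succ_of_ne_zero hk0
  have hr100 : ((R₀ * 100 ^ (j + 1) : ℕ) : ℝ) ≤ 100 * s := by
    have := hmin j (by omega)
    push_cast at this ⊢
    rw [pow_succ]
    linarith
  have hbig := hiter (j + 1) hmin
  have hpack := dbl_packing Γ hc ht x (R₀ * 100 ^ (j + 1))
  have hpack' : (D + 1) * b (R₀ * 100 ^ (j + 1)) ≤
      (Nat.card V : ℝ) * (2 * ((R₀ * 100 ^ (j + 1) : ℕ) : ℝ) + 1) := by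
    simp only [hb, hDdef]
    exact_mod_cast hpack
  have hDq : D ^ q = s ^ (2 * q) := by
    rw [hs, ← Real.rpow_mul hD0]; congr 1; ring
  have hlow : D ^ q ≤ (R₀ : ℝ) ^ (2 * q) * b (R₀ * 100 ^ (j + 1)) := by
    rw [hDq]
    calc s ^ (2 * q) ≤ ((R₀ * 100 ^ (j + 1) : ℕ) : ℝ) ^ (2 * q) :=
          Real.rpow_le_rpow hs0 hk.le (by positivity)
      _ = (R₀ : ℝ) ^ (2 * q) * ((100 : ℝ) ^ (j + 1)) ^ (2 * q) := by
          push_cast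
          rw [Real.mul_rpow (by positivity) (by positivity)]
      _ ≤ _ := mul_le_mul_of_nonneg_left hbig hpos.le
  have hs1 : 1 ≤ s := by
    have : 0 < 300 * C * (R₀ : ℝ) ^ (2 * q) := by positivity
    linarith
  have hDpos : 0 < D := by rw [← hss]; positivity
  have hDqpos : 0 < D ^ q := Real.rpow_pos_of_pos hDpos q
  set r : ℝ := ((R₀ * 100 ^ (j + 1) : ℕ) : ℝ) with hr
  set B : ℝ := b (R₀ * 100 ^ (j + 1)) with hB
  set A : ℝ := (R₀ : ℝ) ^ (2 * q) with hA
  have f1 : (D + 1) * D ^ q ≤ (A * C * (300 * s)) * D ^ q := by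
    calc (D + 1) * D ^ q ≤ (D + 1) * (A * B) := mul_le_mul_of_nonneg_left hlow (by positivity)
      _ = A * ((D + 1) * B) := by ring
      _ ≤ A * ((Nat.card V : ℝ) * (2 * r + 1)) := mul_le_mul_of_nonneg_left hpack' hpos.le
      _ ≤ A * ((C * D ^ q) * (300 * s)) := by
          refine mul_le_mul_of_nonneg_left ?_ hpos.le
          exact mul_le_mul hcard (by linarith) (by positivity) (by positivity)
      _ = _ := by ring
  have f2 := le_of_mul_le_mul_right f1 hDqpos
  rw [← hss] at f2
  nlinarith
end

section
/- Let X be a finite connected vertex-transitive graph of diameter D, let ε, c > 0, and suppose X contains a 3-caret of branch length R for some integer R ≥ ε·D^c. Then |X| > (1/2)·ε^{log₃4 − 1}·D^{1 + c(log₃4 − 1)}. -/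
/-- A 3-caret of branch length `R` at `v₀`: three geodesic paths of length `R`
starting at `v₀` (so `d(v₀, γᵢ(k)) = k` for `k ≤ R`) which are pairwise
separated: `d(γᵢ(kᵢ), γⱼ(kⱼ)) ≥ max(kᵢ, kⱼ)` for `i ≠ j`. -/
def IsThreeCaret {V : Type*} (Γ : SimpleGraph V) (R : ℕ) (v₀ : V) : Prop :=
  ∃ γ : Fin 3 → ℕ → V,
    (∀ i, γ i 0 = v₀) ∧
    (∀ i, ∀ k < R, Γ.Adj (γ i k) (γ i (k + 1))) ∧
    (∀ i, ∀ k ≤ R, Γ.dist v₀ (γ i k) = k) ∧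
    (∀ i j, i ≠ j → ∀ k ≤ R, ∀ k' ≤ R, max k k' ≤ Γ.dist (γ i k) (γ j k'))

open Classical in
noncomputable def cBall {V : Type*} [Fintype V] (Γ : SimpleGraph V) (v : V) (r : ℕ) : Finset V :=
  Finset.univ.filter (fun w => Γ.dist v w ≤ r)

theorem mem_cBall {V : Type*} [Fintype V] (Γ : SimpleGraph V) (v w : V) (r : ℕ) :
    w ∈ cBall Γ v r ↔ Γ.dist v w ≤ r := by
  simp [cBall]

theorem dist_iso_le {V : Type*} (Γ : SimpleGraph V) (hconn : Γ.Connected) (φ : Γ ≃g Γ) (u v : V) :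
    Γ.dist (φ u) (φ v) ≤ Γ.dist u v := by
  obtain ⟨p, hp⟩ := hconn.exists_walk_length_eq_dist u v
  rw [← hp, ← SimpleGraph.Walk.length_map φ.toHom p]
  exact SimpleGraph.dist_le _

theorem card_cBall_le {V : Type*} [Fintype V] (Γ : SimpleGraph V) (hconn : Γ.Connected)
    (htrans : ∀ u v : V, ∃ φ : Γ ≃g Γ, φ u = v) (u v : V) (r : ℕ) :
    (cBall Γ u r).card ≤ (cBall Γ v r).card := by
  obtain ⟨φ, rfl⟩ := htrans u v
  refine Finset.card_le_card_of_injOn φ ?_ φ.injective.injOn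
  intro w hw
  have hw' := (mem_cBall Γ u w r).1 hw
  exact (mem_cBall Γ _ _ r).2 ((dist_iso_le Γ hconn φ u w).trans hw')

theorem packing {V : Type*} [Fintype V] (Γ : SimpleGraph V) (hconn : Γ.Connected)
    (htrans : ∀ u v : V, ∃ φ : Γ ≃g Γ, φ u = v) {ι : Type} [Fintype ι] (f : ι → V) (v : V) (r : ℕ)
    (hf : ∀ i j, i ≠ j → 2 * r + 1 ≤ Γ.dist (f i) (f j)) (S : Finset V)
    (hS : ∀ i, cBall Γ (f i) r ⊆ S) :
    Fintype.card ι * (cBall Γ v r).card ≤ S.card := by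
  classical
  have h1 : (Finset.univ.biUnion (fun i => cBall Γ (f i) r)).card
      = ∑ i, (cBall Γ (f i) r).card := by
    apply Finset.card_biUnion
    intro i _ j _ hij
    rw [Function.onFun, Finset.disjoint_left]
    intro w hw1 hw2
    rw [mem_cBall] at hw1 hw2
    have h := hf i j hij
    have h2 := hconn.dist_triangle (u := f i) (v := w) (w := f j)
    rw [SimpleGraph.dist_comm (u := w)] at h2
    omega
  calc Fintype.card ι * (cBall Γ v r).card = ∑ i : ι, (cBall Γ v r).card := by simp
    _ ≤ ∑ i, (cBall Γ (f i) r).card :=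
        Finset.sum_le_sum (fun i _ => card_cBall_le Γ hconn htrans _ _ _)
    _ = _ := h1.symm
    _ ≤ S.card := Finset.card_le_card (Finset.biUnion_subset.2 (fun i _ => hS i))

theorem ball_growth {V : Type*} [Fintype V] (Γ : SimpleGraph V) (hconn : Γ.Connected)
    (htrans : ∀ u v : V, ∃ φ : Γ ≃g Γ, φ u = v) (R : ℕ) (v₀ : V) (hcaret : IsThreeCaret Γ R v₀)
    (r : ℕ) (hr : 2 * r + 1 ≤ R) :
    4 * (cBall Γ v₀ r).card ≤ (cBall Γ v₀ (3 * r + 1)).card := by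
  obtain ⟨γ, -, -, h2, h3⟩ := hcaret
  have := packing Γ hconn htrans
    (fun o : Option (Fin 3) => o.elim v₀ (fun i => γ i (2 * r + 1))) v₀ r ?_
    (cBall Γ v₀ (3 * r + 1)) ?_
  · simpa using this
  · rintro (_ | i) (_ | j) hij
    · exact absurd rfl hij
    · simp [h2 j _ hr]
    · simp only [Option.elim]
      rw [SimpleGraph.dist_comm, h2 i _ hr]
    · have := h3 i j (fun h => hij (by rw [h])) _ hr _ hr
      simpa using this
  · rintro (_ | i) w hw
    · rw [mem_cBall] at *
      simp only [Option.elim] at hw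
      omega
    · rw [mem_cBall] at *
      simp only [Option.elim] at hw
      have := hconn.dist_triangle (u := v₀) (v := γ i (2 * r + 1)) (w := w)
      rw [h2 i _ hr] at this
      omega

theorem ball_pow {V : Type*} [Fintype V] (Γ : SimpleGraph V) (hconn : Γ.Connected)
    (htrans : ∀ u v : V, ∃ φ : Γ ≃g Γ, φ u = v) (R : ℕ) (v₀ : V) (hcaret : IsThreeCaret Γ R v₀)
    (n : ℕ) (hn : ∀ m < n, 3 ^ m ≤ R) :
    ∃ r, 2 * r + 1 = 3 ^ n ∧ 4 ^ n ≤ (cBall Γ v₀ r).card := by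
  induction n with
  | zero =>
    refine ⟨0, by simp, ?_⟩
    simp only [pow_zero]
    exact Finset.card_pos.2 ⟨v₀, by simp [mem_cBall]⟩
  | succ n ih =>
    obtain ⟨r, hr, hb⟩ := ih (fun m hm => hn m (by omega))
    refine ⟨3 * r + 1, by rw [pow_succ]; omega, ?_⟩
    have := ball_growth Γ hconn htrans R v₀ hcaret r (hr ▸ hn n (by omega))
    rw [pow_succ]; omega

theorem diam_packing {V : Type*} [Fintype V] (Γ : SimpleGraph V) (hconn : Γ.Connected)
    (htrans : ∀ u v : V, ∃ φ : Γ ≃g Γ, φ u = v) (v₀ : V) (r : ℕ) :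
    (Γ.diam + 1) * (cBall Γ v₀ r).card ≤ (2 * r + 1) * Fintype.card V := by
  have : Nonempty V := ⟨v₀⟩
  obtain ⟨u, v, huv⟩ := Γ.exists_dist_eq_diam
  have hex : ∀ k, k ≤ Γ.diam → ∃ w, Γ.dist u w = k := by
    intro k hk
    obtain ⟨p, hp⟩ := hconn.exists_walk_length_eq_dist u v
    refine ⟨p.getVert k, ?_⟩
    have h1 := SimpleGraph.dist_le (p.take k)
    have h2 := SimpleGraph.dist_le (p.drop k)
    have h3 := hconn.dist_triangle (u := u) (v := p.getVert k) (w := v)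
    have h4 : (p.take k).length ≤ k := by simp
    have h5 : (p.drop k).length = p.length - k := by simp
    omega
  choose! g hg using hex
  have := packing Γ hconn htrans
    (fun i : Fin (Γ.diam / (2 * r + 1) + 1) => g (i.1 * (2 * r + 1))) v₀ r ?_ Finset.univ
    (fun _ => Finset.subset_univ _)
  · rw [Fintype.card_fin, Finset.card_univ] at this
    have h6 : Γ.diam + 1 ≤ (2 * r + 1) * (Γ.diam / (2 * r + 1) + 1) := by
      have := Nat.lt_mul_div_succ Γ.diam (b := 2 * r + 1) (by omega)
      omega
    calc _ ≤ (2 * r + 1) * (Γ.diam / (2 * r + 1) + 1) * (cBall Γ v₀ r).card :=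
          Nat.mul_le_mul_right _ h6
      _ ≤ _ := by rw [mul_assoc]; exact Nat.mul_le_mul_left _ this
  · have hle : ∀ i : Fin (Γ.diam / (2 * r + 1) + 1), i.1 * (2 * r + 1) ≤ Γ.diam := fun i =>
      (Nat.le_div_iff_mul_le (by omega)).1 (by omega)
    have key : ∀ i j : Fin (Γ.diam / (2 * r + 1) + 1), i.1 < j.1 →
        2 * r + 1 ≤ Γ.dist (g (i.1 * (2 * r + 1))) (g (j.1 * (2 * r + 1))) := by
      intro i j hij
      have h3 := hconn.dist_triangle (u := u) (v := g (i.1 * (2 * r + 1)))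
        (w := g (j.1 * (2 * r + 1)))
      rw [hg _ (hle i), hg _ (hle j)] at h3
      have : (i.1 + 1) * (2 * r + 1) ≤ j.1 * (2 * r + 1) := Nat.mul_le_mul_right _ hij
      rw [add_mul] at this
      omega
    intro i j hij
    rcases lt_or_gt_of_ne (fun h => hij (Fin.ext h)) with h | h
    · exact key i j h
    · rw [SimpleGraph.dist_comm]; exact key j i h

theorem card_gt_of_three_caret
    {V : Type*} [Fintype V] (Γ : SimpleGraph V)
    (hconn : Γ.Connected)
    (htrans : ∀ u v : V, ∃ φ : Γ ≃g Γ, φ u = v)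
    (ε c : ℝ) (hε : 0 < ε) (hc : 0 < c)
    (R : ℕ) (hR : ε * (Γ.diam : ℝ) ^ c ≤ (R : ℝ))
    (v₀ : V) (hcaret : IsThreeCaret Γ R v₀) :
    (1 / 2) * ε ^ (Real.logb 3 4 - 1) * (Γ.diam : ℝ) ^ (1 + c * (Real.logb 3 4 - 1))
      < (Nat.card V : ℝ) := by
  have ha : 0 < Real.logb 3 4 - 1 := by
    rw [sub_pos, Real.lt_logb_iff_rpow_lt (by norm_num) (by norm_num)]
    norm_num
  have h34 : (3 : ℝ) ^ (Real.logb 3 4 - 1) = 4 / 3 := by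
    rw [Real.rpow_sub (by norm_num), Real.rpow_logb (by norm_num) (by norm_num) (by norm_num)]
    norm_num
  set a := Real.logb 3 4 - 1 with hadef
  have hex : ∃ n, R < 3 ^ n := ⟨R, Nat.lt_pow_self (by norm_num)⟩
  obtain ⟨n, hn1, hn2⟩ : ∃ n, R < 3 ^ n ∧ ∀ m < n, 3 ^ m ≤ R :=
    ⟨Nat.find hex, Nat.find_spec hex, fun m hm => not_lt.1 (Nat.find_min hex hm)⟩
  obtain ⟨r, hr, hb⟩ := ball_pow Γ hconn htrans R v₀ hcaret n hn2
  have hp := diam_packing Γ hconn htrans v₀ r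
  rw [hr] at hp
  have hmain : (Γ.diam + 1) * 4 ^ n ≤ 3 ^ n * Fintype.card V :=
    (Nat.mul_le_mul_left _ hb).trans hp
  have hmainR : ((Γ.diam : ℝ) + 1) * 4 ^ n ≤ 3 ^ n * (Fintype.card V : ℝ) := by
    exact_mod_cast hmain
  rw [Nat.card_eq_fintype_card]
  have hD : (0 : ℝ) ≤ Γ.diam := Nat.cast_nonneg _
  have e1 : (Γ.diam : ℝ) ^ (1 + c * a) = Γ.diam * ((Γ.diam : ℝ) ^ c) ^ a := by
    rw [Real.rpow_add_of_nonneg hD zero_le_one (by positivity), Real.rpow_one, Real.rpow_mul hD]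
  have e2 : ε ^ a * ((Γ.diam : ℝ) ^ c) ^ a = (ε * (Γ.diam : ℝ) ^ c) ^ a :=
    (Real.mul_rpow hε.le (by positivity)).symm
  have e3 : (ε * (Γ.diam : ℝ) ^ c) ^ a ≤ (4 / 3 : ℝ) ^ n := by
    have : ε * (Γ.diam : ℝ) ^ c ≤ (3 : ℝ) ^ n := hR.trans (by exact_mod_cast hn1.le)
    calc _ ≤ ((3 : ℝ) ^ n) ^ a := Real.rpow_le_rpow (by positivity) this ha.le
      _ = _ := by
        rw [← h34, ← Real.rpow_natCast, ← Real.rpow_natCast, ← Real.rpow_mul (by norm_num),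
          ← Real.rpow_mul (by norm_num), mul_comm]
  have e4 : ((Γ.diam : ℝ) + 1) * (4 / 3) ^ n ≤ Fintype.card V := by
    rw [div_pow, ← mul_div_assoc, div_le_iff₀ (by positivity), mul_comm (Fintype.card V : ℝ)]
    exact hmainR
  have e5 : (0 : ℝ) < (4 / 3) ^ n := by positivity
  calc _ = 1 / 2 * (Γ.diam * (ε * (Γ.diam : ℝ) ^ c) ^ a) := by rw [e1, ← e2]; ring
    _ ≤ 1 / 2 * (Γ.diam * (4 / 3) ^ n) := by gcongr
    _ < ((Γ.diam : ℝ) + 1) * (4 / 3) ^ n := by nlinarith [mul_nonneg hD e5.le]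
    _ ≤ _ := e4
end

section
/- Let 0 < c ≤ 1 and set α = √3/576. Suppose X is a finite connected d-regular vertex-transitive graph of diameter D such that |X| < (α/d)·D^{2−c}. Then X contains a geodesic cycle of length greater than D^c, i.e., a cycle v₀, v₁, …, v_{k−1}, v₀ with k > D^c such that d_X(v_i, v_j) = min(|i−j|, k−|i−j|) for all i, j. -/
namespace GeoCyc
open SimpleGraph

variable {V : Type*} {Γ : SimpleGraph V}

/-- Adjacent vertices, both outside the closed ball of radius `r` about `x`. -/
def Out (Γ : SimpleGraph V) (x : V) (r : ℕ) (u v : V) : Prop :=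
  Γ.Adj u v ∧ r < Γ.dist x u ∧ r < Γ.dist x v

/-- Vertices reachable from `y` outside the closed ball of radius `r` about `x`. -/
def Cmp (Γ : SimpleGraph V) (x : V) (r : ℕ) (y : V) : Set V :=
  {z | Relation.ReflTransGen (Out Γ x r) y z}

lemma dist_iso_le (φ : Γ ≃g Γ) (hc : Γ.Connected) (u v : V) :
    Γ.dist (φ u) (φ v) ≤ Γ.dist u v := by
  obtain ⟨p, hp⟩ := hc.exists_walk_length_eq_dist u v
  rw [← hp]
  have := dist_le (p.map φ.toHom)
  simpa using this

lemma dist_iso (φ : Γ ≃g Γ) (hc : Γ.Connected) (u v : V) :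
    Γ.dist (φ u) (φ v) = Γ.dist u v := by
  apply le_antisymm (dist_iso_le φ hc u v)
  simpa using dist_iso_le φ.symm hc (φ u) (φ v)

lemma out_symm (x : V) (r : ℕ) : Std.Symm (Out Γ x r) :=
  ⟨fun _ _ h => ⟨h.1.symm, h.2.2, h.2.1⟩⟩

lemma cmp_symm {x y z : V} {r : ℕ} (h : z ∈ Cmp Γ x r y) : y ∈ Cmp Γ x r z := by
  replace h : Relation.ReflTransGen (Out Γ x r) y z := h
  show Relation.ReflTransGen (Out Γ x r) z y
  induction h with
  | refl => exact .refl
  | tail _ hbc ih => exact Relation.ReflTransGen.head ⟨hbc.1.symm, hbc.2.2, hbc.2.1⟩ ih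

lemma cmp_far {x y z : V} {r : ℕ} (hy : r < Γ.dist x y) (h : z ∈ Cmp Γ x r y) :
    r < Γ.dist x z := by
  replace h : Relation.ReflTransGen (Out Γ x r) y z := h
  induction h with
  | refl => exact hy
  | tail _ hbc ih => exact hbc.2.2

lemma cmp_adj {x y u v : V} {r : ℕ} (hy : r < Γ.dist x y) (h : u ∈ Cmp Γ x r y)
    (ha : Γ.Adj u v) (hv : r < Γ.dist x v) : v ∈ Cmp Γ x r y :=
  Relation.ReflTransGen.tail h ⟨ha, cmp_far hy h, hv⟩

lemma cmp_map (φ : Γ ≃g Γ) (hc : Γ.Connected) {x y z : V} {r : ℕ}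
    (h : z ∈ Cmp Γ x r y) : φ z ∈ Cmp Γ (φ x) r (φ y) := by
  refine Relation.ReflTransGen.lift (p := Out Γ (φ x) r) φ ?_ y z h
  rintro a b ⟨h1, h2, h3⟩
  exact ⟨φ.map_adj_iff.2 h1, by rwa [dist_iso φ hc], by rwa [dist_iso φ hc]⟩

lemma exists_closer (hc : Γ.Connected) {x z : V} {n : ℕ} (h : Γ.dist x z = n + 1) :
    ∃ z', Γ.Adj z z' ∧ Γ.dist x z' = n := by
  obtain ⟨p, hp⟩ := hc.exists_walk_length_eq_dist z x
  rw [dist_comm, h] at hp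
  cases p with
  | nil => simp at hp
  | @cons _ v _ ha q =>
    refine ⟨v, ha, ?_⟩
    simp at hp
    have h1 := dist_le q
    have h2 := hc.dist_triangle (u := x) (v := v) (w := z)
    rw [dist_eq_one_iff_adj.2 ha.symm] at h2
    rw [dist_comm] at h1
    omega

/-- The complement of a component is connected. -/
lemma compl_walk (hc : Γ.Connected) {x y : V} {r : ℕ} (hy : r < Γ.dist x y) (n : ℕ) :
    ∀ z, Γ.dist x z = n → z ∉ Cmp Γ x r y →
      ∃ p : Γ.Walk z x, ∀ u ∈ p.support, u ∉ Cmp Γ x r y := by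
  induction n with
  | zero =>
    intro z hz hn
    obtain rfl := hc.dist_eq_zero_iff.1 hz
    exact ⟨.nil, by simpa using hn⟩
  | succ n ih =>
    intro z hz hn
    obtain ⟨z', ha, hz'⟩ := exists_closer hc hz
    have hn' : z' ∉ Cmp Γ x r y := by
      intro h
      refine hn (cmp_adj hy h ha.symm ?_)
      have := cmp_far hy h
      omega
    obtain ⟨p, hp⟩ := ih z' hz' hn'
    refine ⟨.cons ha p, ?_⟩
    intro u hu
    simp at hu
    rcases hu with rfl | hu
    · exact hn
    · exact hp u hu

lemma walk_cmp {x y z : V} {r : ℕ} (p : Γ.Walk y z) (h : ∀ u ∈ p.support, r < Γ.dist x u) :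
    z ∈ Cmp Γ x r y := by
  induction p with
  | nil => exact .refl
  | @cons u v w ha q ih =>
    have h1 := ih (fun t ht => h t (by simp [ht]))
    exact Relation.ReflTransGen.head ⟨ha, h _ (by simp), h _ (by simp)⟩ h1

lemma cmp_walk {x y z : V} {r : ℕ} (h : z ∈ Cmp Γ x r y) :
    ∃ p : Γ.Walk y z, ∀ u ∈ p.support, u ∈ Cmp Γ x r y := by
  replace h : Relation.ReflTransGen (Out Γ x r) y z := h
  induction h with
  | refl => exact ⟨.nil, by intro u hu; simp at hu; subst hu; exact .refl⟩
  | @tail b c hab hbc ih =>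
    obtain ⟨p, hp⟩ := ih
    refine ⟨p.concat hbc.1, ?_⟩
    intro u hu
    simp [Walk.support_concat] at hu
    rcases hu with hu | rfl
    · exact hp u hu
    · exact Relation.ReflTransGen.tail hab hbc

/-- If `y` is far from `x`, the ball about `y` lies in the component of `y`. -/
lemma ball_sub (hc : Γ.Connected) {x y z : V} {r : ℕ} (hy : 2 * r + 1 ≤ Γ.dist x y)
    (hz : Γ.dist y z ≤ r) : z ∈ Cmp Γ x r y := by
  obtain ⟨p, hp⟩ := hc.exists_walk_length_eq_dist y z
  refine walk_cmp p fun u hu => ?_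
  classical
  have h1 := dist_le (p.takeUntil u hu)
  have h2 := p.length_takeUntil_le_length hu
  have h3 := hc.dist_triangle (u := x) (v := u) (w := y)
  rw [dist_comm (u := u)] at h3
  omega

lemma sep_aux [Finite V] (hc : Γ.Connected) {r : ℕ}
    (H : ∀ x : V, ∃ a b, 2 * r + 1 ≤ Γ.dist x a ∧ 2 * r + 1 ≤ Γ.dist x b ∧ b ∉ Cmp Γ x r a)
    (n : ℕ) : ∀ x y, 2 * r + 1 ≤ Γ.dist x y → (Cmp Γ x r y).ncard = n → False := by
  induction n using Nat.strong_induction_on with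
  | _ n ih =>
    intro x y hxy hn
    obtain ⟨a, b, ha, hb, hab⟩ := H y
    have : ∃ q, 2 * r + 1 ≤ Γ.dist y q ∧ x ∉ Cmp Γ y r q := by
      by_contra! hq
      exact hab (Relation.ReflTransGen.trans (hq a ha) (cmp_symm (hq b hb)))
    obtain ⟨q, hq, hxq⟩ := this
    have hsub : Cmp Γ y r q ⊂ Cmp Γ x r y := by
      refine (Set.ssubset_iff_of_subset ?_).2 ⟨y, .refl, ?_⟩
      · intro z hz
        by_contra hz'
        obtain ⟨p, hp⟩ := compl_walk hc (by omega) _ z rfl hz'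
        refine hxq (Relation.ReflTransGen.trans hz (walk_cmp p fun u hu => ?_))
        by_contra! hle
        exact hp u hu (ball_sub hc hxy hle)
      · intro h
        have := cmp_far (by omega) h
        simp at this
    exact ih _ (hn ▸ Set.ncard_lt_ncard hsub) y q hq rfl

/-- Balls do not separate far away points in a vertex-transitive graph. -/
lemma not_sep [Finite V] (hc : Γ.Connected) (ht : ∀ u v : V, ∃ φ : Γ ≃g Γ, φ u = v)
    {r : ℕ} {o a b : V} (ha : 2 * r + 1 ≤ Γ.dist o a) (hb : 2 * r + 1 ≤ Γ.dist o b) :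
    b ∈ Cmp Γ o r a := by
  by_contra hab
  refine sep_aux hc (r := r) ?_ _ o a ha rfl
  intro x
  obtain ⟨φ, rfl⟩ := ht o x
  refine ⟨φ a, φ b, by rwa [dist_iso φ hc], by rwa [dist_iso φ hc], fun h => hab ?_⟩
  simpa using cmp_map φ.symm hc h

/-- Weight of a walk mod 2. -/
def wt (g : V → V → ZMod 2) : ∀ {u v : V}, Γ.Walk u v → ZMod 2
  | _, _, .nil => 0
  | u, _, .cons (v := v) _ p => g u v + wt g p

lemma wt_append (g : V → V → ZMod 2) {u v w : V} (p : Γ.Walk u v) (q : Γ.Walk v w) :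
    wt g (p.append q) = wt g p + wt g q := by
  induction p with
  | nil => simp [wt]
  | cons h p ih => simp [wt, ih, add_assoc]

lemma wt_reverse (g : V → V → ZMod 2) (hg : ∀ u v, g u v = g v u) {u v : V} (p : Γ.Walk u v) :
    wt g p.reverse = wt g p := by
  induction p with
  | nil => simp [wt]
  | @cons u v w h p ih => simp [wt, ih, wt_append, hg u v, add_comm]

lemma wt_ne_zero (g : V → V → ZMod 2) {u v : V} (p : Γ.Walk u v) (h : wt g p ≠ 0) :
    ∃ a ∈ p.support, ∃ b ∈ p.support, Γ.Adj a b ∧ g a b ≠ 0 := by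
  induction p with
  | nil => simp [wt] at h
  | @cons u v w ha p ih =>
    by_cases hg : g u v = 0
    · rw [wt, hg, zero_add] at h
      obtain ⟨a, h1, b, h2, h3⟩ := ih h
      exact ⟨a, by simp [h1], b, by simp [h2], h3⟩
    · exact ⟨u, by simp, v, by simp, ha, hg⟩

lemma split_walk {u v : V} (p : Γ.Walk u v) {i : ℕ} (hi : i ≤ p.length) :
    ∃ (p₁ : Γ.Walk u (p.getVert i)) (p₂ : Γ.Walk (p.getVert i) v),
      p = p₁.append p₂ ∧ p₁.length = i ∧ p₂.length = p.length - i ∧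
      ∀ j, p₂.getVert j = p.getVert (i + j) := by
  induction p generalizing i with
  | nil => simp at hi; subst hi; exact ⟨.nil, .nil, by simp⟩
  | @cons u v w h p ih =>
    cases i with
    | zero => exact ⟨.nil, .cons h p, rfl, rfl, rfl, fun j => congrArg (Walk.cons h p).getVert (Nat.zero_add j).symm⟩
    | succ i =>
      simp at hi
      obtain ⟨p₁, p₂, h1, h2, h3, h4⟩ := ih hi
      refine ⟨.cons h p₁, p₂, ?_, ?_, ?_, ?_⟩
      · simp [← h1]
      · simp [h2]
      · simp [h3]
      · intro j
        rw [show i + 1 + j = (i + j) + 1 by omega]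
        simpa using h4 j

lemma split_walk3 {u v : V} (p : Γ.Walk u v) {i j : ℕ} (hij : i ≤ j) (hj : j ≤ p.length) :
    ∃ (p₁ : Γ.Walk u (p.getVert i)) (p₂ : Γ.Walk (p.getVert i) (p.getVert j))
      (p₃ : Γ.Walk (p.getVert j) v),
      p = p₁.append (p₂.append p₃) ∧ p₁.length = i ∧ p₂.length = j - i ∧
        p₃.length = p.length - j := by
  obtain ⟨p₁, q, h1, h2, h3, h4⟩ := split_walk p (hij.trans hj)
  obtain ⟨p₂, p₃, h5, h6, h7, h8⟩ := split_walk q (i := j - i) (by omega)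
  have e : q.getVert (j - i) = p.getVert j := by rw [h4]; congr 1; omega
  refine ⟨p₁, p₂.copy rfl e, p₃.copy e rfl, ?_, h2, by simpa using h6, by simp; omega⟩
  refine h1.trans (congrArg p₁.append ?_)
  refine h5.trans ?_
  clear h1 h3 h4 h5 h6 h7 h8
  generalize p.getVert j = b at e
  subst e
  rfl

/-- An odd closed walk of minimal length is a geodesic cycle. -/
lemma exists_cycle (hc : Γ.Connected) (g : V → V → ZMod 2) (hg : ∀ u v, g u v = g v u)
    {u : V} (p : Γ.Walk u u) (hp : wt g p ≠ 0) :
    ∃ (u' : V) (q : Γ.Walk u' u') (k : ℕ) (w : ℕ → V), wt g q ≠ 0 ∧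
      (∀ i < k, Γ.Adj (w i) (w ((i + 1) % k))) ∧
      (∀ i < k, ∀ j < k, Γ.dist (w i) (w j) =
        min (max i j - min i j) (k - (max i j - min i j))) ∧
      ∀ v ∈ q.support, ∃ i < k, w i = v := by
  classical
  have hex : ∃ n, ∃ (u : V) (p : Γ.Walk u u), wt g p ≠ 0 ∧ p.length = n := ⟨_, u, p, hp, rfl⟩
  obtain ⟨u', q, hq, hlen⟩ := Nat.find_spec hex
  have hmin : ∀ (a : V) (s : Γ.Walk a a), s.length < q.length → wt g s = 0 := by
    intro a s hs
    by_contra hne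
    exact Nat.find_min hex (hlen ▸ hs) ⟨a, s, hne, rfl⟩
  have hpos : 0 < q.length := by
    cases q with
    | nil => simp [wt] at hq
    | cons h q => simp
  have key : ∀ i j, i ≤ j → j < q.length → Γ.dist (q.getVert i) (q.getVert j) =
      min (j - i) (q.length - (j - i)) := by
    intro i j hij hj
    obtain ⟨p₁, p₂, p₃, h1, h2, h3, h4⟩ := split_walk3 q hij hj.le
    apply le_antisymm
    · refine le_min (h3 ▸ dist_le p₂) ?_
      have := dist_le (p₃.append p₁)
      rw [dist_comm, Walk.length_append] at this
      omega
    · by_contra! hlt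
      obtain ⟨s, hs⟩ := hc.exists_walk_length_eq_dist (q.getVert i) (q.getVert j)
      have hA := hmin _ (p₂.append s.reverse) (by simp; omega)
      have hB := hmin _ (p₁.append (s.append p₃)) (by simp; omega)
      apply hq
      rw [h1]
      simp only [wt_append, wt_reverse g hg] at hA hB ⊢
      have h2 : wt g s + wt g s = 0 := CharTwo.add_self_eq_zero _
      linear_combination hA + hB - h2
  refine ⟨u', q, q.length, q.getVert, hq, ?_, ?_, ?_⟩
  · intro i hi
    have := q.adj_getVert_succ hi
    rcases Nat.lt_or_ge (i + 1) q.length with h | h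
    · rwa [Nat.mod_eq_of_lt h]
    · have e : i + 1 = q.length := by omega
      rw [e, Nat.mod_self]
      rw [e] at this
      simpa using this
  · intro i hi j hj
    rcases le_total i j with h | h
    · rw [key i j h hj, max_eq_right h, min_eq_left h]
    · rw [dist_comm, key j i h hi, max_eq_left h, min_eq_right h]
  · intro v hv
    obtain ⟨n, hn, hle⟩ := Walk.mem_support_iff_exists_getVert.1 hv
    rcases Nat.lt_or_ge n q.length with h | h
    · exact ⟨n, h, hn⟩
    · refine ⟨0, hpos, ?_⟩
      have : n = q.length := by omega
      subst this
      simpa using hn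

/-- Every geodesic cycle has length at most `K`. -/
def Short (Γ : SimpleGraph V) (K : ℕ) : Prop :=
  ∀ (k : ℕ) (w : ℕ → V), (∀ i < k, Γ.Adj (w i) (w ((i + 1) % k))) →
      (∀ i < k, ∀ j < k, Γ.dist (w i) (w j) =
        min (max i j - min i j) (k - (max i j - min i j))) → k ≤ K

open Classical in
/-- Indicator of the edges joining `S` and `C`. -/
noncomputable def ind (S C : Set V) (u v : V) : ZMod 2 :=
  if (u ∈ S ∧ v ∈ C) ∨ (v ∈ S ∧ u ∈ C) then 1 else 0

lemma ind_symm (S C : Set V) (u v : V) : ind S C u v = ind S C v u := by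
  unfold ind
  congr 1
  exact propext or_comm

open Classical in
lemma wt_cut {S₁ S₂ C : Set V} (h1 : ∀ s ∈ S₁, s ∉ C) (h2 : ∀ s ∈ S₂, s ∉ C)
    (hd : ∀ s ∈ S₁, s ∉ S₂)
    (hcov : ∀ u v, Γ.Adj u v → u ∉ C → v ∈ C → u ∈ S₁ ∨ u ∈ S₂) {u v : V} (p : Γ.Walk u v) :
    wt (ind S₁ C) p + wt (ind S₂ C) p =
      (if u ∈ C then 1 else 0) + (if v ∈ C then 1 else 0) := by
  induction p with
  | nil => simp [wt, CharTwo.add_self_eq_zero]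
  | @cons a b c hab p ih =>
    have e : ind S₁ C a b + ind S₂ C a b =
        (if a ∈ C then 1 else 0) + (if b ∈ C then 1 else 0) := by
      have c1 := hcov a b hab
      have c2 := hcov b a hab.symm
      have a1 := h1 a
      have a2 := h2 a
      have a3 := hd a
      have b1 := h1 b
      have b2 := h2 b
      have b3 := hd b
      have h2 : (1 : ZMod 2) + 1 = 0 := CharTwo.add_self_eq_zero _
      unfold ind
      by_cases ac : a ∈ C <;> by_cases bc : b ∈ C <;> by_cases as : a ∈ S₁ <;>
        by_cases at' : a ∈ S₂ <;> by_cases bs : b ∈ S₁ <;> by_cases bt : b ∈ S₂ <;> simp_all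
    have h2 : (if b ∈ C then (1 : ZMod 2) else 0) + (if b ∈ C then 1 else 0) = 0 :=
      CharTwo.add_self_eq_zero _
    simp only [wt]
    linear_combination e + ih + h2

lemma wt_inside {S C : Set V} (h1 : ∀ s ∈ S, s ∉ C) {u v : V} (p : Γ.Walk u v)
    (h : (∀ x ∈ p.support, x ∈ C) ∨ (∀ x ∈ p.support, x ∉ C)) : wt (ind S C) p = 0 := by
  by_contra hne
  obtain ⟨a, ha, b, hb, -, hab⟩ := wt_ne_zero _ p hne
  apply hab
  unfold ind
  rw [if_neg]
  rcases h with h | h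
  · have := h a ha
    have := h b hb
    have := h1 a
    have := h1 b
    tauto
  · have := h a ha
    have := h b hb
    tauto

/-- Boundary layer of a set. -/
def bd (Γ : SimpleGraph V) (C : Set V) : Set V := {s | s ∉ C ∧ ∃ v ∈ C, Γ.Adj s v}

lemma jump (hc : Γ.Connected) {K : ℕ} (hK : Short Γ K) {x y : V} {r : ℕ}
    (hy : r < Γ.dist x y) {S₁ S₂ : Set V} (hS : S₁ ∪ S₂ = bd Γ (Cmp Γ x r y))
    (hd : ∀ s ∈ S₁, s ∉ S₂) {t₁ t₂ : V} (ht1 : t₁ ∈ S₁) (ht2 : t₂ ∈ S₂) :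
    ∃ s₁ ∈ S₁, ∃ s₂ ∈ S₂, Γ.dist s₁ s₂ ≤ K / 2 := by
  classical
  set C := Cmp Γ x r y with hC
  have b1 : ∀ s ∈ S₁, s ∈ bd Γ C := fun s hs => hS ▸ Or.inl hs
  have b2 : ∀ s ∈ S₂, s ∈ bd Γ C := fun s hs => hS ▸ Or.inr hs
  have n1 : ∀ s ∈ S₁, s ∉ C := fun s hs => (b1 s hs).1
  have n2 : ∀ s ∈ S₂, s ∉ C := fun s hs => (b2 s hs).1
  obtain ⟨-, v₁, hv1, ha1⟩ := b1 _ ht1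
  obtain ⟨-, v₂, hv2, ha2⟩ := b2 _ ht2
  obtain ⟨q₁, hq1⟩ := cmp_walk hv1
  obtain ⟨q₂, hq2⟩ := cmp_walk hv2
  obtain ⟨p₁, hp1⟩ := compl_walk hc hy _ t₁ rfl (n1 _ ht1)
  obtain ⟨p₂, hp2⟩ := compl_walk hc hy _ t₂ rfl (n2 _ ht2)
  let p : Γ.Walk t₁ t₁ := .cons ha1 (q₁.reverse.append (q₂.append (.cons ha2.symm
    (p₂.append p₁.reverse))))
  have hg := ind_symm S₁ C
  have hw : wt (ind S₁ C) p ≠ 0 := by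
    simp only [p, wt, wt_append, wt_reverse _ hg, wt_inside n1 q₁ (.inl hq1),
      wt_inside n1 q₂ (.inl hq2), wt_inside n1 p₁ (.inr hp1), wt_inside n1 p₂ (.inr hp2)]
    have e1 : ind S₁ C t₁ v₁ = 1 := by
      unfold ind; rw [if_pos]; exact .inl ⟨ht1, hv1⟩
    have e2 : ind S₁ C v₂ t₂ = 0 := by
      unfold ind; rw [if_neg]
      have := n2 _ ht2
      have := n1 v₂
      have := hd t₂
      tauto
    simp [e1, e2]
  obtain ⟨u, q, k, w, hq, hadj, hdist, hsup⟩ := exists_cycle hc _ hg p hw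
  have hk := hK k w hadj hdist
  have hq' : wt (ind S₂ C) q ≠ 0 := by
    intro h0
    have := wt_cut n1 n2 hd (fun u v huv hu hv => by
      have : u ∈ bd Γ C := ⟨hu, v, hv, huv⟩
      rwa [← hS] at this) q
    rw [h0, CharTwo.add_self_eq_zero, add_zero] at this
    exact hq this
  have get : ∀ S : Set V, wt (ind S C) q ≠ 0 → ∃ s ∈ S, s ∈ q.support := by
    intro S h
    obtain ⟨a, ha, b, hb, -, hab⟩ := wt_ne_zero _ q h
    unfold ind at hab
    rw [ne_eq, ite_eq_right_iff, Classical.not_imp] at hab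
    rcases hab.1 with h | h
    · exact ⟨a, h.1, ha⟩
    · exact ⟨b, h.1, hb⟩
  obtain ⟨s₁, hs1, hm1⟩ := get _ hq
  obtain ⟨s₂, hs2, hm2⟩ := get _ hq'
  refine ⟨s₁, hs1, s₂, hs2, ?_⟩
  obtain ⟨i, hi, rfl⟩ := hsup _ hm1
  obtain ⟨j, hj, rfl⟩ := hsup _ hm2
  rw [hdist i hi j hj]
  omega

lemma bd_dist (hc : Γ.Connected) {x y s : V} {r : ℕ} (hy : r < Γ.dist x y)
    (hs : s ∈ bd Γ (Cmp Γ x r y)) : Γ.dist x s = r := by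
  obtain ⟨h1, v, hv, ha⟩ := hs
  have h2 := cmp_far hy hv
  have h3 : ¬ r < Γ.dist x s := fun h => h1 (cmp_adj hy hv ha.symm h)
  have h4 := hc.dist_triangle (u := x) (v := s) (w := v)
  rw [dist_eq_one_iff_adj.2 ha] at h4
  omega

lemma sphere_card [Fintype V] (hc : Γ.Connected) {K : ℕ} (hK : Short Γ K) {x y : V} {r : ℕ}
    (hy : r < Γ.dist x y) {s t : V} (hs : s ∈ bd Γ (Cmp Γ x r y))
    (ht : t ∈ bd Γ (Cmp Γ x r y)) :
    Γ.dist s t ≤ (Finset.univ.filter fun v => Γ.dist x v = r).card * (K / 2) := by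
  classical
  have hsub : Finset.range (Γ.dist s t) ⊆
      (Finset.univ.filter fun v => Γ.dist x v = r).biUnion
        fun v => Finset.Ico (Γ.dist s v - K / 2) (Γ.dist s v) := by
    intro m hm
    rw [Finset.mem_range] at hm
    obtain ⟨s₁, h1, s₂, h2, h12⟩ := jump hc hK hy
      (S₁ := {v ∈ bd Γ (Cmp Γ x r y) | Γ.dist s v ≤ m})
      (S₂ := {v ∈ bd Γ (Cmp Γ x r y) | m < Γ.dist s v})
      (by ext v; simp only [Set.mem_union, Set.mem_ofPred_eq]
          have := le_or_gt (Γ.dist s v) m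
          tauto)
      (by rintro v ⟨-, h⟩ ⟨-, h'⟩; omega)
      (t₁ := s) (t₂ := t) ⟨hs, by simp⟩ ⟨ht, hm⟩
    have := hc.dist_triangle (u := s) (v := s₁) (w := s₂)
    simp only [Finset.mem_biUnion, Finset.mem_filter, Finset.mem_univ, true_and, Finset.mem_Ico]
    refine ⟨s₂, bd_dist hc hy h2.1, ?_, h2.2⟩
    have := h1.2
    omega
  have h := Finset.card_le_card hsub
  rw [Finset.card_range] at h
  refine h.trans (Finset.card_biUnion_le_card_mul _ _ _ ?_)
  intro v _
  rw [Nat.card_Ico]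
  omega

lemma geod_dist (hc : Γ.Connected) {a b : V} (p : Γ.Walk a b) (hp : p.length = Γ.dist a b)
    {i j : ℕ} (hij : i ≤ j) (hj : j ≤ p.length) :
    Γ.dist (p.getVert i) (p.getVert j) = j - i := by
  obtain ⟨p₁, p₂, p₃, h1, h2, h3, h4⟩ := split_walk3 p hij hj
  apply le_antisymm (h3 ▸ dist_le p₂)
  have e1 := hc.dist_triangle (u := a) (v := p.getVert i) (w := b)
  have e2 := hc.dist_triangle (u := p.getVert i) (v := p.getVert j) (w := b)
  have e3 := dist_le p₁
  have e4 := dist_le p₃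
  omega

lemma sphere_lower [Fintype V] (hc : Γ.Connected) (ht : ∀ u v : V, ∃ φ : Γ ≃g Γ, φ u = v)
    {K : ℕ} (hK : Short Γ K) {a b : V} (p : Γ.Walk a b) (hp : p.length = Γ.dist a b)
    {r : ℕ} (hr : 4 * r + 2 ≤ p.length) :
    2 * r ≤ (Finset.univ.filter fun v => Γ.dist (p.getVert (p.length / 2)) v = r).card
      * (K / 2) := by
  set m := p.length / 2 with hm
  set o := p.getVert m with ho
  have hL : ∀ i ≤ m, Γ.dist o (p.getVert i) = m - i := by
    intro i hi
    rw [dist_comm, geod_dist hc p hp hi (by omega)]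
  have hR : ∀ i, m ≤ i → i ≤ p.length → Γ.dist o (p.getVert i) = i - m := by
    intro i hi hi'
    rw [geod_dist hc p hp hi hi']
  set y := p.getVert 0 with hy
  have hy0 : Γ.dist o y = m := by rw [hL 0 (by omega)]; omega
  have mem : ∀ z, 2 * r + 1 ≤ Γ.dist o z → z ∈ Cmp Γ o r y := fun z hz =>
    not_sep hc ht (by omega) hz
  have h1 : p.getVert (m - r) ∈ bd Γ (Cmp Γ o r y) := by
    have hb : ∀ n, ∀ i, i = n → i < m - r → p.getVert i ∈ Cmp Γ o r y := by
      intro n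
      induction n with
      | zero => rintro i rfl hi; exact .refl
      | succ n ih =>
        rintro i rfl hi
        refine cmp_adj (by omega) (ih n rfl (by omega)) (p.adj_getVert_succ (by omega)) ?_
        rw [hL _ (by omega)]; omega
    refine ⟨fun h => ?_, p.getVert (m - r - 1), hb _ _ rfl (by omega), ?_⟩
    · have := cmp_far (by omega) h
      rw [hL _ (by omega)] at this
      omega
    · have := p.adj_getVert_succ (i := m - r - 1) (by omega)
      rw [show m - r - 1 + 1 = m - r by omega] at this
      exact this.symm
  have h2 : p.getVert (m + r) ∈ bd Γ (Cmp Γ o r y) := by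
    have hb : ∀ n, ∀ i, i + n = p.length → m + r < i → p.getVert i ∈ Cmp Γ o r y := by
      intro n
      induction n with
      | zero => intro i h hi; exact mem _ (by rw [hR _ (by omega) (by omega)]; omega)
      | succ n ih =>
        intro i h hi
        refine cmp_adj (by omega) (ih (i + 1) (by omega) (by omega))
          (p.adj_getVert_succ (by omega)).symm ?_
        rw [hR _ (by omega) (by omega)]; omega
    refine ⟨fun h => ?_, p.getVert (m + r + 1), hb (p.length - (m + r + 1)) _ (by omega)
      (by omega), p.adj_getVert_succ (by omega)⟩
    have := cmp_far (by omega) h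
    rw [hR _ (by omega) (by omega)] at this
    omega
  have h := sphere_card hc hK (by omega) h1 h2
  rw [geod_dist hc p hp (by omega) (by omega)] at h
  omega

lemma card_lower [Fintype V] (hc : Γ.Connected) (ht : ∀ u v : V, ∃ φ : Γ ≃g Γ, φ u = v)
    {K : ℕ} (hK : Short Γ K) {R : ℕ} (hR : 4 * R + 2 ≤ Γ.diam) :
    R * (R + 1) ≤ Nat.card V * (K / 2) := by
  classical
  have := hc.nonempty
  obtain ⟨a, b, hab⟩ := Γ.exists_dist_eq_diam
  obtain ⟨p, hp⟩ := hc.exists_walk_length_eq_dist a b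
  set o := p.getVert (p.length / 2) with ho
  have h1 : ∑ r ∈ Finset.range (R + 1), 2 * r ≤
      ∑ r ∈ Finset.range (R + 1),
        (Finset.univ.filter fun v => Γ.dist o v = r).card * (K / 2) := by
    refine Finset.sum_le_sum fun r hr => ?_
    rw [Finset.mem_range] at hr
    exact sphere_lower hc ht hK p hp (by omega)
  rw [← Finset.mul_sum, mul_comm, Finset.sum_range_id_mul_two, ← Finset.sum_mul] at h1
  have h2 : ∑ r ∈ Finset.range (R + 1), (Finset.univ.filter fun v => Γ.dist o v = r).card
      ≤ Nat.card V := by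
    rw [Nat.card_eq_fintype_card, ← Finset.card_univ, ← Finset.card_biUnion]
    · exact Finset.card_le_card (Finset.subset_univ _)
    · intro i _ j _ hij
      rw [Function.onFun, Finset.disjoint_left]
      intro v hv hv'
      simp at hv hv'
      omega
  calc R * (R + 1) = (R + 1) * (R + 1 - 1) := by simp [mul_comm]
    _ ≤ _ := h1
    _ ≤ _ := Nat.mul_le_mul_right _ h2

end GeoCyc

/-- **Lemma 4.2.3.** Let `0 < c ≤ 1` and `α = √3/576`. If `X` is a finite
connected `d`-regular vertex-transitive graph of diameter `D` with
`|X| < (α/d)·D^{2−c}`, then `X` contains a geodesic cycle of length `> D^c`: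
a cycle `v₀, …, v_{k−1}, v₀` such that the graph distance between any two of its
vertices equals their distance along the cycle. -/
theorem exists_long_geodesic_cycle
    {V : Type*} [Fintype V] (Γ : SimpleGraph V)
    (hconn : Γ.Connected)
    (htrans : ∀ u v : V, ∃ φ : Γ ≃g Γ, φ u = v)
    (d : ℕ) (hreg : ∀ v : V, (Γ.neighborSet v).ncard = d)
    (c : ℝ) (hc0 : 0 < c) (hc1 : c ≤ 1)
    (hcard : (Nat.card V : ℝ) <
      Real.sqrt 3 / 576 / (d : ℝ) * (Γ.diam : ℝ) ^ ((2 : ℝ) - c)) :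
    ∃ (k : ℕ) (w : ℕ → V),
      (Γ.diam : ℝ) ^ c < (k : ℝ) ∧
      (∀ i < k, Γ.Adj (w i) (w ((i + 1) % k))) ∧
      (∀ i < k, ∀ j < k, Γ.dist (w i) (w j) =
        min (max i j - min i j) (k - (max i j - min i j))) := by
  by_contra! hcon
  set D := Γ.diam with hD
  set N := Nat.card V with hN
  have := hconn.nonempty
  have hN1 : (1 : ℝ) ≤ N := by exact_mod_cast Nat.card_pos (α := V)
  have hDpos : (0 : ℝ) < D := by
    rcases Nat.eq_zero_or_pos D with h | h
    · rw [h, Nat.cast_zero, Real.zero_rpow (by linarith), mul_zero] at hcard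
      linarith
    · exact_mod_cast h
  have hD1 : (1 : ℝ) ≤ D := by
    have : 0 < D := by exact_mod_cast hDpos
    exact_mod_cast this
  have hdpos : (1 : ℝ) ≤ d := by
    rcases Nat.eq_zero_or_pos d with h | h
    · rw [h, Nat.cast_zero, div_zero, zero_mul] at hcard
      linarith
    · exact_mod_cast h
  set L := (D : ℝ) ^ c with hL
  have hL1 : 1 ≤ L := Real.one_le_rpow hD1 hc0.le
  have hpow : (D : ℝ) ^ ((2 : ℝ) - c) * L = D ^ 2 := by
    rw [hL, ← Real.rpow_add hDpos]
    norm_num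
  have hs3 : Real.sqrt 3 ≤ 2 := by
    rw [Real.sqrt_le_left (by norm_num)]
    norm_num
  have hcoef : Real.sqrt 3 / 576 / (d : ℝ) ≤ 1 / 288 := by
    rw [div_le_iff₀ (by linarith)]
    linarith
  have hPpos : 0 ≤ (D : ℝ) ^ ((2 : ℝ) - c) := by positivity
  have hb : (N : ℝ) < 1 / 288 * (D : ℝ) ^ ((2 : ℝ) - c) :=
    hcard.trans_le (mul_le_mul_of_nonneg_right hcoef hPpos)
  have hNL : (N : ℝ) * L < 1 / 288 * (D : ℝ) ^ 2 := by
    rw [← hpow, ← mul_assoc]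
    exact mul_lt_mul_of_pos_right hb (by linarith)
  have hDbig : (16 : ℝ) < D := by nlinarith
  have hDbig' : 16 < D := by exact_mod_cast hDbig
  have hK : GeoCyc.Short Γ ⌊L⌋₊ := by
    intro k w h1 h2
    refine Nat.le_floor ?_
    by_contra! hlt
    obtain ⟨i, hi, j, hj, hne⟩ := hcon k w hlt h1
    exact hne (h2 i hi j hj)
  have hlow := GeoCyc.card_lower hconn htrans hK (R := (D - 2) / 4) (by omega)
  have hR : D ≤ 4 * ((D - 2) / 4) + 5 := by omega
  set R := (D - 2) / 4
  have hR' : (D : ℝ) ≤ 4 * R + 5 := by exact_mod_cast hR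
  have hlow' : (R : ℝ) * (R + 1) ≤ N * ((⌊L⌋₊ / 2 : ℕ) : ℝ) := by exact_mod_cast hlow
  have hM : ((⌊L⌋₊ / 2 : ℕ) : ℝ) ≤ L := by
    have h1 : ((⌊L⌋₊ / 2 : ℕ) : ℝ) ≤ (⌊L⌋₊ : ℝ) := by exact_mod_cast Nat.div_le_self _ _
    exact h1.trans (Nat.floor_le (by linarith))
  have h3 : (R : ℝ) * (R + 1) ≤ N * L :=
    hlow'.trans (mul_le_mul_of_nonneg_left hM (by linarith))
  nlinarith
end
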